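/- arXiv:2209.10072 — 2 statements merged into one kernel-verified Lean document; each statement's English description precedes it below -/
import Mathlib

section
/- Let S and A be finite nonempty sets, P a transition kernel on S×A, R : S×A → ℝ, γ ∈ [0,1), λ > 0, and Qπ : S×A → ℝ. Then the regularized Bellman operator B̂ has a unique fixed point Q* : S×A → ℝ, i.e., there exists exactly one table Q* satisfying Q*(s,a) = (λ/(1+λ))·Qπ(s,a) + (1/(1+λ))·(R(s,a) + γ·Σ_{s'} P(s'|s,a)·max_{a'} Q*(s',a')) for all (s,a). -/
open Finset

/-- Max over actions of a Q-table at a state. -/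
noncomputable def maxQ {S A : Type*} [Fintype A] [Nonempty A] (Q : S × A → ℝ) (s : S) : ℝ :=
  Finset.univ.sup' Finset.univ_nonempty (fun a => Q (s, a))

theorem abs_maxQ_sub_le {S A : Type*} [Fintype S] [Fintype A] [Nonempty A]
    (Q Q' : S × A → ℝ) (s : S) : |maxQ Q s - maxQ Q' s| ≤ dist Q Q' := by
  have key : ∀ U V : S × A → ℝ, maxQ U s ≤ maxQ V s + dist U V := by
    intro U V
    refine Finset.sup'_le _ _ fun a _ => ?_
    have h1 : V (s, a) ≤ maxQ V s :=
      Finset.le_sup' (fun a => V (s, a)) (Finset.mem_univ a)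
    have h2 := dist_le_pi_dist U V (s, a)
    rw [Real.dist_eq] at h2
    linarith [le_abs_self (U (s, a) - V (s, a))]
  have h := key Q' Q
  rw [dist_comm] at h
  exact abs_sub_le_iff.2 ⟨by linarith [key Q Q'], by linarith⟩

theorem abs_sum_mul_maxQ_sub_le {S A : Type*} [Fintype S] [Fintype A] [Nonempty A]
    {p : S → ℝ} (hp0 : ∀ s, 0 ≤ p s) (hp1 : ∑ s, p s = 1) (Q Q' : S × A → ℝ) :
    |∑ s, p s * maxQ Q s - ∑ s, p s * maxQ Q' s| ≤ dist Q Q' := by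
  calc |∑ s, p s * maxQ Q s - ∑ s, p s * maxQ Q' s|
      = |∑ s, p s * (maxQ Q s - maxQ Q' s)| := by
        simp only [mul_sub, Finset.sum_sub_distrib]
    _ ≤ ∑ s, |p s * (maxQ Q s - maxQ Q' s)| := Finset.abs_sum_le_sum_abs _ _
    _ ≤ ∑ s, p s * dist Q Q' := by
        refine Finset.sum_le_sum fun s _ => ?_
        rw [abs_mul, abs_of_nonneg (hp0 s)]
        exact mul_le_mul_of_nonneg_left (abs_maxQ_sub_le Q Q' s) (hp0 s)
    _ = dist Q Q' := by rw [← Finset.sum_mul, hp1, one_mul]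

/-- the regularized Bellman operator has a unique fixed point `Q*`, i.e.
there is exactly one table `Q*` with
`Q*(s,a) = (λ/(1+λ))·Qπ(s,a) + (1/(1+λ))·(R(s,a) + γ·Σ_{s'} P(s'|s,a)·max_{a'} Q*(s',a'))`. -/
theorem bhat_unique_fixed_point {S A : Type*} [Fintype S] [Fintype A] [Nonempty S] [Nonempty A]
    (P : S → A → S → ℝ) (R : S → A → ℝ) (γ lam : ℝ) (Qpi : S × A → ℝ)
    (hP0 : ∀ s a s', 0 ≤ P s a s') (hP1 : ∀ s a, ∑ s', P s a s' = 1)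
    (hγ0 : 0 ≤ γ) (hγ1 : γ < 1) (hlam : 0 < lam) :
    ∃! Qstar : S × A → ℝ, ∀ s a,
      Qstar (s, a) = (lam / (1 + lam)) * Qpi (s, a) +
        (1 / (1 + lam)) * (R s a + γ * ∑ s', P s a s' * maxQ Qstar s') := by
  let B : (S × A → ℝ) → S × A → ℝ := fun Q x =>
    (lam / (1 + lam)) * Qpi x +
      (1 / (1 + lam)) * (R x.1 x.2 + γ * ∑ s', P x.1 x.2 s' * maxQ Q s')
  have hB : ContractingWith ⟨γ, hγ0⟩ B := by
    refine ⟨by exact_mod_cast hγ1, LipschitzWith.of_dist_le_mul fun Q Q' => ?_⟩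
    change dist (B Q) (B Q') ≤ γ * dist Q Q'
    refine (dist_pi_le_iff (by positivity)).2 fun x => ?_
    have hsum := abs_sum_mul_maxQ_sub_le (hP0 x.1 x.2) (hP1 x.1 x.2) Q Q'
    have hc0 : 0 ≤ 1 / (1 + lam) := by positivity
    have hc1 : 1 / (1 + lam) ≤ 1 := by
      rw [div_le_one (by linarith)]
      linarith
    have hdiff : B Q x - B Q' x = 1 / (1 + lam) * (γ *
        (∑ s', P x.1 x.2 s' * maxQ Q s' - ∑ s', P x.1 x.2 s' * maxQ Q' s')) := by
      simp only [B]
      ring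
    rw [Real.dist_eq, hdiff, abs_mul, abs_mul, abs_of_nonneg hc0, abs_of_nonneg hγ0]
    exact (mul_le_of_le_one_left (by positivity) hc1).trans
      (mul_le_mul_of_nonneg_left hsum hγ0)
  refine ⟨hB.fixedPoint B, fun s a => ?_, fun Q hQ => ?_⟩
  · exact (congrFun hB.fixedPoint_isFixedPt (s, a)).symm
  · exact hB.fixedPoint_unique (funext fun x => (hQ x.1 x.2).symm)
end

section
/- Let S, A be finite nonempty sets, P a transition kernel, R : S×A → ℝ with |R(s,a)| ≤ Rmax for all (s,a), γ ∈ [0,1), λ > 0, and Qπ : S×A → ℝ. Then the unique fixed point Q* of the regularized Bellman operator B̂ satisfies ‖Q*‖∞ ≤ (λ·‖Qπ‖∞ + Rmax)/(1 + λ − γ). -/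
open Finset

/-- The regularized Bellman operator. -/
noncomputable def Bhat {S A : Type*} [Fintype S] [Fintype A] [Nonempty A]
    (P : S → A → S → ℝ) (R : S → A → ℝ) (γ lam : ℝ) (Qpi : S × A → ℝ)
    (Q : S × A → ℝ) : S × A → ℝ :=
  fun sa => (lam / (1 + lam)) * Qpi sa +
    (1 / (1 + lam)) * (R sa.1 sa.2 + γ * ∑ s' : S, P sa.1 sa.2 s' * maxQ Q s')

/-- The maximum over actions is bounded in absolute value by the sup norm of the table. -/
theorem abs_maxQ_le_norm {S A : Type*} [Fintype S] [Fintype A] [Nonempty A]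
    (Q : S × A → ℝ) (s : S) : |maxQ Q s| ≤ ‖Q‖ := by
  obtain ⟨a, -, ha⟩ := Finset.exists_mem_eq_sup' Finset.univ_nonempty (fun a => Q (s, a))
  rw [maxQ, ha]
  exact norm_le_pi_norm Q (s, a)

/-- An average of values bounded in absolute value by `C` is bounded by `C`. -/
theorem abs_sum_mul_le_of_sum_eq_one {ι : Type*} [Fintype ι] {p f : ι → ℝ} {C : ℝ}
    (hp : ∀ i, 0 ≤ p i) (hsum : ∑ i, p i = 1) (hf : ∀ i, |f i| ≤ C) :
    |∑ i, p i * f i| ≤ C :=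
  calc |∑ i, p i * f i| ≤ ∑ i, |p i * f i| := Finset.abs_sum_le_sum_abs _ _
    _ ≤ ∑ i, p i * C := Finset.sum_le_sum fun i _ => by
      rw [abs_mul, abs_of_nonneg (hp i)]
      exact mul_le_mul_of_nonneg_left (hf i) (hp i)
    _ = C := by rw [← Finset.sum_mul, hsum, one_mul]

/-- if `|R(s,a)| ≤ Rmax` for all `(s,a)`, then the unique fixed point `Q*`
of the regularized Bellman operator satisfies `‖Q*‖∞ ≤ (λ·‖Qπ‖∞ + Rmax)/(1 + λ − γ)`. -/
theorem fixed_point_norm_bound {S A : Type*} [Fintype S] [Fintype A]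
    [Nonempty S] [Nonempty A]
    (P : S → A → S → ℝ) (R : S → A → ℝ) (γ lam Rmax : ℝ) (Qpi : S × A → ℝ)
    (hP0 : ∀ s a s', 0 ≤ P s a s') (hP1 : ∀ s a, ∑ s', P s a s' = 1)
    (hγ0 : 0 ≤ γ) (hγ1 : γ < 1) (hlam : 0 < lam)
    (hRb : ∀ s a, |R s a| ≤ Rmax)
    (Qstar : S × A → ℝ) (hfix : Bhat P R γ lam Qpi Qstar = Qstar) :
    ‖Qstar‖ ≤ (lam * ‖Qpi‖ + Rmax) / (1 + lam - γ) := by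
  have hlam1 : 0 < 1 + lam := by linarith
  have hle : ‖Qstar‖ ≤ (lam * ‖Qpi‖ + (Rmax + γ * ‖Qstar‖)) / (1 + lam) := by
    refine (pi_norm_le_iff_of_nonempty _).2 fun ⟨s, a⟩ => ?_
    have hval : Qstar (s, a) =
        (lam * Qpi (s, a) + (R s a + γ * ∑ s', P s a s' * maxQ Qstar s')) / (1 + lam) := by
      conv_lhs => rw [← hfix]
      simp only [Bhat]
      ring
    have havg := abs_sum_mul_le_of_sum_eq_one (hP0 s a) (hP1 s a) (abs_maxQ_le_norm Qstar)
    have hpi : |Qpi (s, a)| ≤ ‖Qpi‖ := norm_le_pi_norm Qpi (s, a)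
    rw [hval, Real.norm_eq_abs, abs_div, abs_of_pos hlam1]
    gcongr
    refine (abs_add_le _ _).trans (add_le_add ?_ ((abs_add_le _ _).trans (add_le_add (hRb s a) ?_)))
    · rw [abs_mul, abs_of_pos hlam]
      gcongr
    · rw [abs_mul, abs_of_nonneg hγ0]
      gcongr
  rw [le_div_iff₀ hlam1] at hle
  rw [le_div_iff₀ (by linarith)]
  linarith
end
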